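/- Let r > 0, d, ν ∈ ℕ, M ∈ ℝ^{d×d}, let f : ℝ → ℝ^d be differentiable with f′(τ) = M f(τ) for all τ ∈ ℝ, and let y : ℝ → ℝ^ν be continuous. Then the function t ↦ ∫_{-r}^0 (f(τ) ⊗ I_ν) y(t + τ) dτ is differentiable on ℝ and its derivative at any t equals (f(0) ⊗ I_ν) y(t) − (f(−r) ⊗ I_ν) y(t − r) − (M ⊗ I_ν) ∫_{-r}^0 (f(τ) ⊗ I_ν) y(t + τ) dτ. -/

import Mathlib

open MeasureTheory Matrix
open scoped Kronecker

/-- `F_ν(τ) = f(τ) ⊗ I_ν ∈ ℝ^{dν×ν}`. -/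
noncomputable def kronColId (d ν : ℕ) (f : ℝ → Fin d → ℝ) (τ : ℝ) :
    Matrix (Fin d × Fin ν) (Fin ν) ℝ :=
  Matrix.of fun p j => f τ p.1 * (1 : Matrix (Fin ν) (Fin ν) ℝ) p.2 j

lemma scalar_delay_aux (r : ℝ) (φ φ' z : ℝ → ℝ) (hφ : ∀ τ, HasDerivAt φ (φ' τ) τ)
    (hφ' : Continuous φ') (hz : Continuous z) (t : ℝ) :
    HasDerivAt (fun t => ∫ τ in (-r)..0, φ τ * z (t + τ))
      (φ 0 * z t - φ (-r) * z (t - r) - ∫ τ in (-r)..0, φ' τ * z (t + τ)) t := by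
  set Y : ℝ → ℝ := fun s => ∫ x in (0:ℝ)..s, z x with hYdef
  have hY : ∀ s, HasDerivAt Y (z s) s := fun s =>
    intervalIntegral.integral_hasDerivAt_right (hz.intervalIntegrable _ _)
      (hz.stronglyMeasurableAtFilter _ _) hz.continuousAt
  have hYc : Continuous Y := continuous_iff_continuousAt.2 fun s => (hY s).continuousAt
  have hparts : (fun t => ∫ τ in (-r)..0, φ τ * z (t + τ)) = fun t =>
      φ 0 * Y t - φ (-r) * Y (t - r) - ∫ τ in (-r)..0, φ' τ * Y (t + τ) := by
    funext s
    have := intervalIntegral.integral_mul_deriv_eq_deriv_mul (a := -r) (b := 0)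
      (u := φ) (u' := φ') (v := fun τ => Y (s + τ)) (v' := fun τ => z (s + τ))
      (fun x _ => hφ x) (fun x _ => HasDerivAt.comp_const_add s x (hY (s + x)))
      (hφ'.intervalIntegrable _ _)
      ((hz.comp (continuous_const.add continuous_id)).intervalIntegrable _ _)
    simpa [sub_eq_add_neg] using this
  rw [hparts]
  have h1 : HasDerivAt (fun t => Y (t - r)) (z (t - r)) t :=
    HasDerivAt.comp_sub_const t r (hY (t - r))
  have hc : Continuous (fun p : ℝ × ℝ => φ' p.2 * z (p.1 + p.2)) := by fun_prop
  obtain ⟨C, hC⟩ := ((isCompact_closedBall t 1).prod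
    (isCompact_uIcc (a := -r) (b := 0))).exists_bound_of_continuousOn hc.continuousOn
  have h2 : HasDerivAt (fun t => ∫ τ in (-r)..0, φ' τ * Y (t + τ))
      (∫ τ in (-r)..0, φ' τ * z (t + τ)) t := by
    refine (intervalIntegral.hasDerivAt_integral_of_dominated_loc_of_deriv_le
      (F := fun s τ => φ' τ * Y (s + τ)) (F' := fun s τ => φ' τ * z (s + τ))
      (bound := fun _ => C)
      (Metric.ball_mem_nhds t one_pos) ?_ ?_ ?_ ?_ ?_ ?_).2
    · exact Filter.Eventually.of_forall fun s => Continuous.aestronglyMeasurable (by fun_prop)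
    · exact Continuous.intervalIntegrable (by fun_prop) _ _
    · exact Continuous.aestronglyMeasurable (by fun_prop)
    · exact Filter.Eventually.of_forall fun τ hτ s hs =>
        hC (s, τ) ⟨Metric.ball_subset_closedBall hs, Set.uIoc_subset_uIcc hτ⟩
    · exact intervalIntegrable_const
    · exact Filter.Eventually.of_forall fun τ hτ s hs =>
        (HasDerivAt.comp_add_const s τ (hY (s + τ))).const_mul (φ' τ)
  exact (((hY t).const_mul _).sub (h1.const_mul _)).sub h2

lemma kronColId_mulVec_aux (d ν : ℕ) (f : ℝ → Fin d → ℝ) (τ : ℝ) (v : Fin ν → ℝ)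
    (p : Fin d × Fin ν) : (kronColId d ν f τ *ᵥ v) p = f τ p.1 * v p.2 := by
  simp [kronColId, Matrix.mulVec, dotProduct, Matrix.one_apply]

theorem deriv_of_distributed_delay_term (d ν : ℕ) (r : ℝ) (hr : 0 < r)
    (M : Matrix (Fin d) (Fin d) ℝ)
    (f : ℝ → Fin d → ℝ) (hf : ∀ τ, HasDerivAt f (M *ᵥ f τ) τ)
    (y : ℝ → Fin ν → ℝ) (hy : Continuous y)
    (g : ℝ → Fin d × Fin ν → ℝ)
    (hg : g = fun t => ∫ τ in (-r)..0, kronColId d ν f τ *ᵥ y (t + τ)) :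
    ∀ t : ℝ, HasDerivAt g
      (kronColId d ν f 0 *ᵥ y t - kronColId d ν f (-r) *ᵥ y (t - r)
        - (M ⊗ₖ (1 : Matrix (Fin ν) (Fin ν) ℝ)) *ᵥ g t) t := by
  intro t
  have hfc : Continuous f := continuous_iff_continuousAt.2 fun s => (hf s).continuousAt
  have hgp : ∀ s p, g s p = ∫ τ in (-r)..0, f τ p.1 * y (s + τ) p.2 := by
    intro s p
    have hc : Continuous (fun τ => kronColId d ν f τ *ᵥ y (s + τ)) := by
      refine continuous_pi fun q => ?_
      simp only [kronColId_mulVec_aux]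
      fun_prop
    have := (ContinuousLinearMap.proj (R := ℝ) (φ := fun _ : Fin d × Fin ν => ℝ) p).intervalIntegral_comp_comm
      (hc.intervalIntegrable (μ := volume) (-r) 0)
    simp only [ContinuousLinearMap.proj_apply, kronColId_mulVec_aux] at this
    rw [hg, this]
  rw [hasDerivAt_pi]
  rintro ⟨i, j⟩
  have key := scalar_delay_aux r (fun τ => f τ i) (fun τ => (M *ᵥ f τ) i) (fun s => y s j)
    (fun τ => (hasDerivAt_pi.1 (hf τ)) i)
    (by simp only [Matrix.mulVec, dotProduct]; fun_prop) (by fun_prop) t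
  have e : (fun s => g s (i, j)) = fun s => ∫ τ in (-r)..0, f τ i * y (s + τ) j :=
    funext fun s => hgp s (i, j)
  rw [e]
  refine key.congr_deriv ?_
  rw [Pi.sub_apply, Pi.sub_apply, kronColId_mulVec_aux, kronColId_mulVec_aux]
  symm
  congr 1
  have : ((M ⊗ₖ (1 : Matrix (Fin ν) (Fin ν) ℝ)) *ᵥ g t) (i, j) = ∑ k, M i k * g t (k, j) := by
    simp [Matrix.mulVec, dotProduct, Fintype.sum_prod_type, Matrix.one_apply]
  rw [this]
  simp only [hgp, Matrix.mulVec, dotProduct, Finset.sum_mul]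
  rw [intervalIntegral.integral_finsetSum]
  · refine Finset.sum_congr rfl fun k _ => ?_
    rw [← intervalIntegral.integral_const_mul]
    simp only [mul_assoc]
  · intro k _
    exact Continuous.intervalIntegrable (by fun_prop) _ _
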